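/- Decay of |u| toward ±1 away from the interface (Euclidean version): let n ≥ 1 and s ∈ (0,1). There exists C = C(n,s) > 0 such that for every ε > 0, R > 0, p ∈ ℝ^n, and every bounded Lipschitz solution u : ℝ^n → (-1,1) of the fractional Allen–Cahn equation with parameters s, ε in B_R(p) ⊆ ℝ^n: if u ≥ 9/10 on B_R(p), then 0 ≤ 1-u ≤ C·(ε/R)^s on B_{R/2}(p); symmetrically, if u ≤ -9/10 on B_R(p), then 0 ≤ 1+u ≤ C·(ε/R)^s on B_{R/2}(p). -/

import Mathlib

open MeasureTheory Real Set Metric Filter Topology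

noncomputable section

/-- Euclidean `n`-space. -/
abbrev Rn (n : ℕ) : Type := EuclideanSpace ℝ (Fin n)

/-- The normalizing constant `α_{n,s}` of the fractional Laplacian kernel. -/
def alphaC (n : ℕ) (s : ℝ) : ℝ :=
  s * 2 ^ (s - 1) * Real.Gamma (((n : ℝ) + s) / 2) /
    (Real.pi ^ ((n : ℝ) / 2) * Real.Gamma (1 - s / 2))

/-- The fractional kernel `α_{n,s} |x-y|^{-(n+s)}`. -/
def fracKer (n : ℕ) (s : ℝ) (x y : Rn n) : ℝ :=
  alphaC n s * ‖x - y‖ ^ (-((n : ℝ) + s))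

/-- The double-well potential `W(t) = (1-t²)²/4`. -/
def Wpot (t : ℝ) : ℝ := (1 - t ^ 2) ^ 2 / 4

/-- `u` solves the fractional Allen–Cahn equation
`(-Δ)^{s/2} u + ε^{-s} W'(u) = 0` (with `W'(t) = t³ - t`) in the open set `O`. -/
def IsACSol (n : ℕ) (s ε : ℝ) (u : Rn n → ℝ) (O : Set (Rn n)) : Prop :=
  ∀ x ∈ O, (∫ y, (u x - u y) * fracKer n s x y) + ε ^ (-s) * (u x ^ 3 - u x) = 0

/-- The second-variation quadratic form of the fractional Allen–Cahn energy at `u` in `Ω`,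
with `W''(t) = 3t² - 1`. -/
def Qform (n : ℕ) (s ε : ℝ) (u : Rn n → ℝ) (Ω : Set (Rn n)) (ξ : Rn n → ℝ) : ℝ :=
  (1 / 4) * (∫ p in ((Ωᶜ ×ˢ Ωᶜ)ᶜ : Set (Rn n × Rn n)),
      (ξ p.1 - ξ p.2) ^ 2 * fracKer n s p.1 p.2) +
    ε ^ (-s) * ∫ x in Ω, (3 * u x ^ 2 - 1) * ξ x ^ 2

/-- `ξ` is a `C¹` function compactly supported in `Ω`. -/
def IsCc1On (n : ℕ) (Ω : Set (Rn n)) (ξ : Rn n → ℝ) : Prop :=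
  ContDiff ℝ 1 ξ ∧ HasCompactSupport ξ ∧ tsupport ξ ⊆ Ω

/-- The Morse index of `u` in `Ω` is at most `m`: there is no `(m+1)`-dimensional subspace
of `C_c¹(Ω)` on which the second variation is negative definite. -/
def ACMorseIndexLE (n : ℕ) (s ε : ℝ) (u : Rn n → ℝ) (Ω : Set (Rn n)) (m : ℕ) : Prop :=
  ∀ ξ : Fin (m + 1) → Rn n → ℝ, (∀ i, IsCc1On n Ω (ξ i)) → LinearIndependent ℝ ξ →
    ∃ a : Fin (m + 1) → ℝ, a ≠ 0 ∧ 0 ≤ Qform n s ε u Ω (fun x => ∑ i, a i * ξ i x)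

/-- `u` is `Λ`-almost stable in `Ω`: `Q_Ω(ξ) ≥ -Λ (∫_Ω |ξ|)²` for all `ξ ∈ C_c¹(Ω)`. -/
def AlmostStable (n : ℕ) (s ε Λ : ℝ) (u : Rn n → ℝ) (Ω : Set (Rn n)) : Prop :=
  ∀ ξ : Rn n → ℝ, IsCc1On n Ω ξ → -(Λ * (∫ x in Ω, |ξ x|) ^ 2) ≤ Qform n s ε u Ω ξ

end

noncomputable section

/-- The integrand `min(1,|t|) |t|^{-(n+s)}` bounding the action of the fractional kernel on
a bounded Lipschitz function. -/
def kerProfile (n : ℕ) (s t : ℝ) : ℝ := min 1 t * t ^ (-((n : ℝ) + s))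

lemma kerProfile_nonneg (n : ℕ) (s : ℝ) {t : ℝ} (ht : 0 ≤ t) : 0 ≤ kerProfile n s t :=
  mul_nonneg (le_min zero_le_one ht) (rpow_nonneg ht _)

lemma integrable_kerProfile_norm {n : ℕ} (hn : 1 ≤ n) {s : ℝ} (hs : s ∈ Set.Ioo (0 : ℝ) 1) :
    Integrable (fun y : Rn n => kerProfile n s ‖y‖) := by
  have : Nonempty (Fin n) := ⟨⟨0, hn⟩⟩
  rw [integrable_fun_norm_addHaar (volume : Measure (Rn n)) (f := kerProfile n s)]
  have hpow {t : ℝ} (ht : 0 < t) : t ^ (n - 1) = t ^ ((n : ℝ) - 1) := by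
    rw [← rpow_natCast, Nat.cast_sub hn, Nat.cast_one]
  rw [finrank_euclideanSpace_fin, ← Ioc_union_Ioi_eq_Ioi (zero_le_one (α := ℝ)),
    integrableOn_union]
  constructor
  · have h : IntegrableOn (fun t : ℝ => t ^ (-s)) (Ioc 0 1) :=
      (intervalIntegrable_iff_integrableOn_Ioc_of_le zero_le_one).1
        (intervalIntegral.intervalIntegrable_rpow' (by linarith [hs.2]))
    refine h.congr_fun (fun t ht => ?_) measurableSet_Ioc
    simp only [kerProfile, smul_eq_mul, min_eq_right ht.2]
    rw [hpow ht.1]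
    nth_rewrite 3 [← rpow_one t]
    rw [← rpow_add ht.1, ← rpow_add ht.1]
    congr 1
    ring
  · have h : IntegrableOn (fun t : ℝ => t ^ (-1 - s)) (Ioi 1) :=
      integrableOn_Ioi_rpow_of_lt (by linarith [hs.1]) one_pos
    refine h.congr_fun (fun t ht => ?_) measurableSet_Ioi
    have ht0 : 0 < t := one_pos.trans ht
    simp only [kerProfile, smul_eq_mul, min_eq_left (le_of_lt (mem_Ioi.1 ht)), one_mul]
    rw [hpow ht0, ← rpow_add ht0]
    congr 1
    ring

lemma min_mul_rpow_eq_kerProfile (n : ℕ) (s : ℝ) {r t : ℝ} (hr : 0 < r) (ht : 0 ≤ t) :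
    min 1 (t / r) * t ^ (-((n : ℝ) + s)) =
      r ^ (-((n : ℝ) + s)) * kerProfile n s (r⁻¹ * t) := by
  rw [kerProfile, mul_rpow (inv_nonneg.2 hr.le) ht, inv_rpow hr.le, div_eq_inv_mul]
  have := (rpow_pos_of_pos hr (-((n : ℝ) + s))).ne'
  field_simp

lemma min_mul_rpow_norm_sub_eq (n : ℕ) (s : ℝ) {r : ℝ} (hr : 0 < r) (z y : Rn n) :
    min 1 (‖z - y‖ / r) * ‖z - y‖ ^ (-((n : ℝ) + s)) =
      r ^ (-((n : ℝ) + s)) * kerProfile n s ‖r⁻¹ • (z - y)‖ := by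
  rw [min_mul_rpow_eq_kerProfile n s hr (norm_nonneg _), norm_smul, norm_inv, norm_of_nonneg hr.le]

lemma integrable_min_mul_rpow_norm_sub {n : ℕ} (hn : 1 ≤ n) {s : ℝ}
    (hs : s ∈ Set.Ioo (0 : ℝ) 1) {r : ℝ} (hr : 0 < r) (z : Rn n) :
    Integrable (fun y : Rn n => min 1 (‖z - y‖ / r) * ‖z - y‖ ^ (-((n : ℝ) + s))) := by
  simp only [min_mul_rpow_norm_sub_eq n s hr]
  exact (((integrable_kerProfile_norm hn hs).comp_smul (inv_ne_zero hr.ne')).comp_sub_left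
    z).const_mul _

lemma integral_min_mul_rpow_norm_sub (n : ℕ) (s : ℝ) {r : ℝ} (hr : 0 < r) (z : Rn n) :
    ∫ y : Rn n, min 1 (‖z - y‖ / r) * ‖z - y‖ ^ (-((n : ℝ) + s)) =
      r ^ (-s) * ∫ y : Rn n, kerProfile n s ‖y‖ := by
  simp only [min_mul_rpow_norm_sub_eq n s hr]
  rw [integral_const_mul,
    integral_sub_left_eq_self (fun y : Rn n => kerProfile n s ‖r⁻¹ • y‖) volume z,
    Measure.integral_comp_inv_smul_of_nonneg volume (fun y : Rn n => kerProfile n s ‖y‖) hr.le,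
    finrank_euclideanSpace_fin, smul_eq_mul, ← mul_assoc, ← rpow_natCast, ← rpow_add hr]
  congr 2
  ring

lemma alphaC_nonneg (n : ℕ) {s : ℝ} (hs : s ∈ Set.Ioo (0 : ℝ) 1) : 0 ≤ alphaC n s := by
  have h0 := hs.1
  have h1 := hs.2
  have hG : 0 < Real.Gamma (((n : ℝ) + s) / 2) := Real.Gamma_pos_of_pos (by positivity)
  have hG' : 0 < Real.Gamma (1 - s / 2) := Real.Gamma_pos_of_pos (by linarith)
  unfold alphaC
  positivity

lemma IsACSol.neg {n : ℕ} {s ε : ℝ} {u : Rn n → ℝ} {O : Set (Rn n)} (h : IsACSol n s ε u O) :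
    IsACSol n s ε (fun x => -u x) O := by
  intro x hx
  have hI : ∫ y, (-u x - -u y) * fracKer n s x y = -∫ y, (u x - u y) * fracKer n s x y := by
    rw [← integral_neg]
    congr 1 with y
    ring
  rw [hI]
  linear_combination -(h x hx)

/-- Touching `u` from below by a truncated cone: some `z` in the closed ball around `x₀` has
`u z ≤ u x₀`, and `u` decreases away from `z` no faster than `2 min(1, |z - y| / r)`. -/
lemma exists_touching_cone {n : ℕ} {u : Rn n → ℝ} (hu : ∀ x, u x ∈ Set.Ioo (-1 : ℝ) 1)
    (hc : Continuous u) {r : ℝ} (hr : 0 < r) (x₀ : Rn n) :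
    ∃ z ∈ closedBall x₀ r, u z ≤ u x₀ ∧ ∀ y, u z - u y ≤ 2 * min 1 (‖z - y‖ / r) := by
  have hcont : Continuous (fun y => u y + 2 * (dist y x₀ / r)) := by fun_prop
  obtain ⟨z, hz, hmin⟩ := (isCompact_closedBall x₀ r).exists_isMinOn
    ⟨x₀, mem_closedBall_self hr.le⟩ hcont.continuousOn
  have hx₀ : u z + 2 * (dist z x₀ / r) ≤ u x₀ := by
    simpa using hmin (mem_closedBall_self hr.le)
  have hd : 0 ≤ dist z x₀ / r := by positivity
  refine ⟨z, hz, by linarith, fun y => ?_⟩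
  rw [mul_min_of_nonneg _ _ zero_le_two]
  refine le_min (by linarith [(hu z).2, (hu y).1]) ?_
  have hle : u z + 2 * (dist z x₀ / r) ≤ u y + 2 * (dist y x₀ / r) := by
    by_cases hy : y ∈ closedBall x₀ r
    · exact hmin hy
    · have : 1 ≤ dist y x₀ / r := (one_le_div hr).2 (not_le.1 hy).le
      linarith [(hu x₀).2, (hu y).1]
  have htri : dist y x₀ / r ≤ ‖z - y‖ / r + dist z x₀ / r := by
    rw [← add_div, ← dist_eq_norm, dist_comm z y]
    gcongr
    exact dist_triangle _ _ _
  linarith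

lemma integral_sub_mul_fracKer_le {n : ℕ} (hn : 1 ≤ n) {s : ℝ} (hs : s ∈ Set.Ioo (0 : ℝ) 1)
    {u : Rn n → ℝ} {r : ℝ} (hr : 0 < r) {z : Rn n}
    (hz : ∀ y, u z - u y ≤ 2 * min 1 (‖z - y‖ / r)) :
    ∫ y, (u z - u y) * fracKer n s z y ≤
      2 * alphaC n s * (∫ y : Rn n, kerProfile n s ‖y‖) * r ^ (-s) := by
  have hα := alphaC_nonneg n hs
  have hint := (integrable_min_mul_rpow_norm_sub hn hs hr z).const_mul (2 * alphaC n s)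
  have hval : ∫ y : Rn n, 2 * alphaC n s *
      (min 1 (‖z - y‖ / r) * ‖z - y‖ ^ (-((n : ℝ) + s))) =
      2 * alphaC n s * (∫ y : Rn n, kerProfile n s ‖y‖) * r ^ (-s) := by
    rw [integral_const_mul, integral_min_mul_rpow_norm_sub n s hr]
    ring
  rw [← hval]
  by_cases hf : Integrable (fun y => (u z - u y) * fracKer n s z y)
  · refine integral_mono hf hint fun y => ?_
    have hK : 0 ≤ fracKer n s z y := mul_nonneg hα (rpow_nonneg (norm_nonneg _) _)
    refine (mul_le_mul_of_nonneg_right (hz y) hK).trans_eq ?_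
    simp only [fracKer]
    ring
  · rw [integral_undef hf]
    exact integral_nonneg fun y => by positivity

lemma one_sub_le_of_isACSol {n : ℕ} (hn : 1 ≤ n) {s : ℝ} (hs : s ∈ Set.Ioo (0 : ℝ) 1)
    {ε R : ℝ} (hε : 0 < ε) (hR : 0 < R) {p : Rn n} {u : Rn n → ℝ}
    (hu : ∀ x, u x ∈ Set.Ioo (-1 : ℝ) 1) (hc : Continuous u)
    (hsol : IsACSol n s ε u (ball p R)) (hge : ∀ x ∈ ball p R, 9 / 10 ≤ u x)
    {x : Rn n} (hx : x ∈ ball p (R / 2)) :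
    1 - u x ≤ 2 * alphaC n s * (∫ y : Rn n, kerProfile n s ‖y‖) * 4 ^ s * (ε / R) ^ s := by
  have hr : 0 < R / 4 := by positivity
  obtain ⟨z, hz, hzx, htouch⟩ := exists_touching_cone hu hc hr x
  have hzR : z ∈ ball p R := by
    rw [mem_ball] at hx ⊢
    rw [mem_closedBall] at hz
    linarith [dist_triangle z x p]
  have hI := integral_sub_mul_fracKer_le hn hs hr htouch
  have heq := hsol z hzR
  have h9 := hge z hzR
  have h1 := (hu z).2
  have hεs : 0 < ε ^ s := rpow_pos_of_pos hε s
  have hreact : 1 - u z ≤ u z - u z ^ 3 := by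
    nlinarith [mul_nonneg (sub_nonneg.2 h1.le) (by nlinarith : 0 ≤ u z * (1 + u z) - 1)]
  have hscale : (4 : ℝ) ^ s * (ε / R) ^ s = ε ^ s * (R / 4) ^ (-s) := by
    rw [rpow_neg hr.le, div_rpow hε.le hR.le, div_rpow hR.le (by norm_num)]
    have := (rpow_pos_of_pos hR s).ne'
    field_simp
  have hreact' : ε ^ s * (∫ y, (u z - u y) * fracKer n s z y) = u z - u z ^ 3 := by
    rw [rpow_neg hε.le] at heq
    field_simp at heq
    linarith
  calc 1 - u x ≤ 1 - u z := by linarith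
    _ ≤ ε ^ s * (∫ y, (u z - u y) * fracKer n s z y) := hreact.trans_eq hreact'.symm
    _ ≤ ε ^ s * (2 * alphaC n s * (∫ y : Rn n, kerProfile n s ‖y‖) * (R / 4) ^ (-s)) := by
      gcongr
    _ = 2 * alphaC n s * (∫ y : Rn n, kerProfile n s ‖y‖) * 4 ^ s * (ε / R) ^ s := by
      rw [mul_assoc _ ((4 : ℝ) ^ s), hscale]
      ring

/-- **Decay of `|u|` toward `±1` away from the interface** (Lemma 3.21 of the paper,
Euclidean version): there is `C = C(n,s)` such that for any bounded Lipschitz solution of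
fractional Allen–Cahn in `B_R(p)`: if `u ≥ 9/10` on `B_R(p)` then `0 ≤ 1-u ≤ C(ε/R)^s` on
`B_{R/2}(p)`, and symmetrically for `u ≤ -9/10`. -/
theorem decay_toward_pm_one
    (n : ℕ) (hn : 1 ≤ n) (s : ℝ) (hs : s ∈ Set.Ioo (0 : ℝ) 1) :
    ∃ C : ℝ, 0 < C ∧
    ∀ ε R : ℝ, 0 < ε → 0 < R → ∀ p : Rn n,
    ∀ u : Rn n → ℝ, (∀ x, u x ∈ Set.Ioo (-1 : ℝ) 1) →
      (∃ K : NNReal, LipschitzWith K u) →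
      IsACSol n s ε u (Metric.ball p R) →
      ((∀ x ∈ Metric.ball p R, 9 / 10 ≤ u x) →
        ∀ x ∈ Metric.ball p (R / 2), 0 ≤ 1 - u x ∧ 1 - u x ≤ C * (ε / R) ^ s) ∧
      ((∀ x ∈ Metric.ball p R, u x ≤ -(9 / 10)) →
        ∀ x ∈ Metric.ball p (R / 2), 0 ≤ 1 + u x ∧ 1 + u x ≤ C * (ε / R) ^ s) := by
  set C₀ := 2 * alphaC n s * (∫ y : Rn n, kerProfile n s ‖y‖) * 4 ^ s
  have hM : 0 ≤ ∫ y : Rn n, kerProfile n s ‖y‖ :=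
    integral_nonneg fun y => kerProfile_nonneg n s (norm_nonneg y)
  have hα := alphaC_nonneg n hs
  have hC₀ : 0 ≤ C₀ := by positivity
  refine ⟨C₀ + 1, by positivity, fun ε R hε hR p u hu ⟨K, hK⟩ hsol => ?_⟩
  have hq : C₀ * (ε / R) ^ s ≤ (C₀ + 1) * (ε / R) ^ s := by
    gcongr
    linarith
  refine ⟨fun hge x hx => ⟨by linarith [(hu x).2], ?_⟩,
    fun hle x hx => ⟨by linarith [(hu x).1], ?_⟩⟩
  · exact (one_sub_le_of_isACSol hn hs hε hR hu hK.continuous hsol hge hx).trans hq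
  · have hu' : ∀ x, -u x ∈ Set.Ioo (-1 : ℝ) 1 := fun x =>
      ⟨neg_lt_neg (hu x).2, neg_lt.1 (hu x).1⟩
    have := one_sub_le_of_isACSol hn hs hε hR hu' hK.continuous.neg hsol.neg
      (fun y hy => le_neg.1 (hle y hy)) hx
    rw [sub_neg_eq_add] at this
    exact this.trans hq

end
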